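/- Let T be a tiered tree on {1,…,n} (n ≥ 2) with tiering function t, let K_t be the complete tiered graph with respect to t with edges ordered lexicographically by their endpoints, let v be the vertex of smallest label, let T_1,…,T_l be the connected components of T − v, and let u_i be the vertex of T_i adjacent to v. Then for each i, the number w_i = #{u ∈ T_i : t(u) > t(v) and u < u_i} equals the number of edges of K_t joining v to a vertex of T_i that are externally active with respect to the spanning tree T. -/

import Mathlib

open scoped Classical

/-- Reachability along a finite edge set (edges are unordered pairs of naturals). -/
def EReach (E : Finset (Sym2 ℕ)) : ℕ → ℕ → Prop :=
  Relation.ReflTransGen fun a b => s(a, b) ∈ E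

/-- `E` is the edge set of a tree on the vertex set `V`: all edges join distinct
vertices of `V`, any two vertices of `V` are joined by a walk, and the number of
edges is one less than the number of vertices. -/
def IsTreeOn (V : Finset ℕ) (E : Finset (Sym2 ℕ)) : Prop :=
  (∀ e ∈ E, ∀ x ∈ e, x ∈ V) ∧ (∀ e ∈ E, ¬ e.IsDiag) ∧
    (∀ a ∈ V, ∀ b ∈ V, EReach E a b) ∧ E.card + 1 = V.card

/-- `t` is a tiering function (with tiers `1, …, m`) for the graph with vertex set `V`
and edge set `E`: tiers lie in `{1, …, m}` and if `a < b` are adjacent then `t a < t b`. -/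
def IsTieredOn (V : Finset ℕ) (E : Finset (Sym2 ℕ)) (m : ℕ) (t : ℕ → ℕ) : Prop :=
  (∀ v ∈ V, t v ∈ Finset.Icc 1 m) ∧ ∀ a b : ℕ, s(a, b) ∈ E → a < b → t a < t b

/-- Auxiliary fuelled recursion computing the weight of a tiered tree: delete the
minimal vertex `v`, and sum, over the components `C` of the resulting forest
(one for each neighbour `u` of `v`), the weight of the component plus the number
of vertices `x ∈ C` with `t x > t v` and `x < u`.  (Fuel `V.card` always suffices,
since components are strictly smaller.) -/
noncomputable def treeWeightAux (t : ℕ → ℕ) : ℕ → Finset ℕ → Finset (Sym2 ℕ) → ℕ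
  | 0, _, _ => 0
  | fuel + 1, V, E =>
    if h : 2 ≤ V.card then
      let v := V.min' (Finset.card_pos.mp (by omega))
      let E' := E.filter fun e => v ∉ e
      ((V.erase v).filter fun u => s(v, u) ∈ E).sum fun u =>
        let C := (V.erase v).filter fun x => EReach E' u x
        (C.filter fun x => t v < t x ∧ x < u).card +
          treeWeightAux t fuel C (E'.filter fun e => ∀ x ∈ e, x ∈ C)
    else 0

/-- The weight of a tiered tree with vertex set `V`, edge set `E` and tiering function `t`. -/
noncomputable def treeWeight (V : Finset ℕ) (E : Finset (Sym2 ℕ)) (t : ℕ → ℕ) : ℕ :=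
  treeWeightAux t V.card V E

/-- The (smaller, larger) endpoints of an edge. -/
def edgeKey (e : Sym2 ℕ) : ℕ × ℕ :=
  Sym2.lift ⟨fun a b => (min a b, max a b), fun a b => by simp [min_comm, max_comm]⟩ e

/-- Lexicographic comparison of edges by their ordered pairs of endpoints. -/
def edgeLexLt (e f : Sym2 ℕ) : Prop :=
  (edgeKey e).1 < (edgeKey f).1 ∨ ((edgeKey e).1 = (edgeKey f).1 ∧ (edgeKey e).2 < (edgeKey f).2)

/-- The complete tiered graph on vertex set `V` with respect to `t`: there is an
edge between every pair of vertices `a < b` with `t a < t b`. -/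
def completeTiered (V : Finset ℕ) (t : ℕ → ℕ) : Finset (Sym2 ℕ) :=
  ((V ×ˢ V).filter fun p => p.1 < p.2 ∧ t p.1 < t p.2).image fun p => s(p.1, p.2)

/-- `e` is externally active for the spanning tree `T` of `K` (edges ordered
lexicographically by endpoints): `e ∈ K \ T` and `e` is the least edge of the unique
cycle of `T ∪ {e}`, i.e. `e` is smaller than every edge `f` of `T` whose removal
disconnects the endpoints of `e` (these `f`, together with `e`, form that cycle). -/
def ExtActive (T K : Finset (Sym2 ℕ)) (e : Sym2 ℕ) : Prop :=
  e ∈ K ∧ e ∉ T ∧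
    ∀ f ∈ T, ¬ EReach (T.erase f) (edgeKey e).1 (edgeKey e).2 → edgeLexLt e f

/-- The external activity of `T` in `K`: the number of externally active edges. -/
noncomputable def extActivity (T K : Finset (Sym2 ℕ)) : ℕ :=
  (K.filter (ExtActive T K)).card

/-- A finite graph that connects a nonempty vertex set `V` has at least `V.card - 1` edges. -/
lemma card_le_card_add_one_of_eReach {V : Finset ℕ} {F : Finset (Sym2 ℕ)}
    (hV : V.Nonempty) (hF : ∀ e ∈ F, ∀ x ∈ e, x ∈ V)
    (hr : ∀ a ∈ V, ∀ b ∈ V, EReach F a b) : V.card ≤ F.card + 1 := by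
  let G : SimpleGraph V :=
    { Adj := fun a b => a ≠ b ∧ s((a : ℕ), (b : ℕ)) ∈ F
      symm := ⟨fun a b h => ⟨h.1.symm, by rw [Sym2.eq_swap]; exact h.2⟩⟩
      loopless := ⟨fun a h => h.1 rfl⟩ }
  have reach : ∀ (a : V) (b : ℕ), EReach F a b → ∃ hb : b ∈ V, G.Reachable a ⟨b, hb⟩ := by
    intro a b h
    induction h with
    | refl => exact ⟨a.2, SimpleGraph.Reachable.refl _⟩
    | @tail b c _ hbc ih =>
      obtain ⟨hb, hab⟩ := ih
      have hc : c ∈ V := hF _ hbc c (by simp)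
      refine ⟨hc, ?_⟩
      by_cases hne : b = c
      · subst hne
        exact hab
      · have hadj : G.Adj ⟨b, hb⟩ ⟨c, hc⟩ := ⟨fun h => hne (congrArg Subtype.val h), hbc⟩
        exact hab.trans hadj.reachable
  have hconn : G.Connected := by
    obtain ⟨a, ha⟩ := hV
    exact { preconnected := fun a b => (reach a b (hr a a.2 b b.2)).2, nonempty := ⟨⟨a, ha⟩⟩ }
  have hmap : ∀ e : G.edgeSet, Sym2.map Subtype.val (e : Sym2 V) ∈ F := by
    rintro ⟨e, he⟩
    induction e with
    | h a b => exact he.2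
  have hle : Nat.card G.edgeSet ≤ Nat.card F :=
    Nat.card_le_card_of_injective
      (fun e : G.edgeSet => (⟨Sym2.map Subtype.val (e : Sym2 V), hmap e⟩ : F))
      fun e f h => Subtype.ext (Sym2.map.injective Subtype.val_injective (congrArg Subtype.val h))
  have hcard := hconn.card_vert_le_card_edgeSet_add_one
  simp only [Nat.card_eq_fintype_card, Fintype.card_coe] at hle hcard
  omega

/-- Reachability is symmetric. -/
lemma EReach.symm {F : Finset (Sym2 ℕ)} {a b : ℕ} (h : EReach F a b) : EReach F b a := by
  have : Std.Symm fun a b => s(a, b) ∈ F := ⟨fun x y hxy => by rwa [Sym2.eq_swap]⟩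
  exact Relation.ReflTransGen.stdSymm.symm _ _ h

/-- Reachability is monotone in the edge set. -/
lemma EReach.mono {F F' : Finset (Sym2 ℕ)} (hFF' : F ⊆ F') {a b : ℕ} (h : EReach F a b) :
    EReach F' a b :=
  Relation.ReflTransGen.mono (fun _ _ hxy => hFF' hxy) _ _ h

/-- Every edge of a tree is a bridge. -/
lemma IsTreeOn.not_eReach_erase {V : Finset ℕ} {E : Finset (Sym2 ℕ)} (hT : IsTreeOn V E)
    {a b : ℕ} (hab : s(a, b) ∈ E) : ¬ EReach (E.erase s(a, b)) a b := by
  intro h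
  obtain ⟨hE, -, hr, hcard⟩ := hT
  have hle := card_le_card_add_one_of_eReach (V := V) (F := E.erase s(a, b))
    ⟨a, hE _ hab a (by simp)⟩ (fun e he => hE e (Finset.mem_of_mem_erase he)) fun x hx y hy => by
      refine Relation.ReflTransGen.trans_induction_on (hr x hx y hy)
        (fun _ => Relation.ReflTransGen.refl) (fun {c d} hcd => ?_) fun _ _ => .trans
      by_cases hcd' : s(c, d) = s(a, b)
      · rcases Sym2.eq_iff.mp hcd' with ⟨rfl, rfl⟩ | ⟨rfl, rfl⟩
        · exact h
        · exact h.symm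
      · exact Relation.ReflTransGen.single (Finset.mem_erase.mpr ⟨hcd', hcd⟩)
  have := Finset.card_pos.mpr ⟨_, hab⟩
  rw [Finset.card_erase_of_mem hab] at hle
  omega

/-- Let `T` be a tiered tree on `{1,…,n}` (`n ≥ 2`) with tiering
function `t`, let `K_t` be the complete tiered graph (edges ordered lexicographically
by endpoints), let `v` be the vertex of smallest label, and let `C` be the connected
component of `T − v` containing a neighbour `u` of `v`.  Then
`w_C = #{x ∈ C : t x > t v and x < u}` equals the number of edges of `K_t` joining `v`
to a vertex of `C` that are externally active with respect to the spanning tree `T`. -/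
theorem component_weight_eq_external_activity
    (n m : ℕ) (hn : 2 ≤ n) (hm : 2 ≤ m)
    (E : Finset (Sym2 ℕ)) (t : ℕ → ℕ)
    (hT : IsTreeOn (Finset.Icc 1 n) E)
    (ht : IsTieredOn (Finset.Icc 1 n) E m t)
    (hne : (Finset.Icc 1 n).Nonempty)
    (v : ℕ) (hv : v = (Finset.Icc 1 n).min' hne)
    (u : ℕ) (hu : s(v, u) ∈ E)
    (C : Finset ℕ)
    (hC : C = ((Finset.Icc 1 n).erase v).filter fun x =>
        EReach (E.filter fun e => v ∉ e) u x) :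
    (C.filter fun x => t v < t x ∧ x < u).card
      = (C.filter fun x =>
          ExtActive E (completeTiered (Finset.Icc 1 n) t) (s(v, x))).card := by
  have hv1 : v = 1 := by
    rw [hv]
    exact le_antisymm (Finset.min'_le _ _ (Finset.mem_Icc.mpr ⟨le_rfl, by omega⟩))
      (Finset.mem_Icc.mp (Finset.min'_mem _ hne)).1
  have hvn : v ∈ Finset.Icc 1 n := Finset.mem_Icc.mpr ⟨hv1.ge, by omega⟩
  have hvu : v ≠ u := fun h => hT.2.1 _ hu (Sym2.mk_isDiag_iff.mpr h)
  have hun : u ∈ Finset.Icc 1 n := hT.1 _ hu u (by simp)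
  have hbridge := hT.not_eReach_erase hu
  congr 1
  apply Finset.filter_congr
  intro x hx
  rw [hC, Finset.mem_filter, Finset.mem_erase] at hx
  obtain ⟨⟨hxv, hxn⟩, hux⟩ := hx
  have hvx : v < x := by
    rw [Finset.mem_Icc] at hxn
    omega
  have hux_erase : ∀ f, v ∈ f → EReach (E.erase f) u x := fun f hf =>
    hux.mono fun e he => by
      rw [Finset.mem_filter] at he
      exact Finset.mem_erase.mpr ⟨fun h => he.2 (h ▸ hf), he.1⟩
  have hkey : ∀ y, v ≤ y → edgeKey s(v, y) = (v, y) := fun y hy => by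
    simp [edgeKey, hy]
  have hvu_le : v ≤ u := by
    rw [Finset.mem_Icc] at hun
    omega
  have hmem : s(v, x) ∈ completeTiered (Finset.Icc 1 n) t ↔ t v < t x := by
    simp only [completeTiered, Finset.mem_image, Finset.mem_filter, Finset.mem_product,
      Prod.exists]
    constructor
    · rintro ⟨a, b, ⟨-, hab, htab⟩, h⟩
      rcases Sym2.eq_iff.mp h with ⟨rfl, rfl⟩ | ⟨rfl, rfl⟩
      · exact htab
      · omega
    · exact fun h => ⟨v, x, ⟨⟨hvn, hxn⟩, hvx, h⟩, rfl⟩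
  unfold ExtActive
  rw [hmem, hkey x hvx.le]
  refine and_congr_right fun _ => ⟨fun hxu => ⟨fun hxE => ?_, fun f hf hsep => ?_⟩, ?_⟩
  · refine hbridge (Relation.ReflTransGen.head ?_ (hux_erase _ (by simp)).symm)
    refine Finset.mem_erase.mpr ⟨fun h => ?_, hxE⟩
    exact hxu.ne (Sym2.congr_right.mp h)
  · unfold edgeLexLt
    rw [hkey x hvx.le]
    by_cases hvf : v ∈ f
    · obtain ⟨y, rfl⟩ := hvf
      have hyu : y = u := by
        by_contra hyu
        refine hsep (Relation.ReflTransGen.head ?_ (hux_erase _ (by simp)))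
        exact Finset.mem_erase.mpr ⟨fun h => hyu (Sym2.congr_right.mp h).symm, hu⟩
      subst hyu
      rw [hkey y hvu_le]
      exact Or.inr ⟨rfl, hxu⟩
    · left
      induction f with
      | h a b =>
        have ha := Finset.mem_Icc.mp (hT.1 _ hf a (by simp))
        have hb := Finset.mem_Icc.mp (hT.1 _ hf b (by simp))
        simp only [Sym2.mem_iff, not_or] at hvf
        simp only [edgeKey, Sym2.lift_mk, lt_min_iff]
        omega
  · rintro ⟨-, hmin⟩
    have hlt := hmin _ hu fun h => hbridge (h.trans (hux_erase _ (by simp)).symm)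
    unfold edgeLexLt at hlt
    rw [hkey x hvx.le, hkey u hvu_le] at hlt
    rcases hlt with h | h
    · exact absurd h (lt_irrefl _)
    · exact h.2
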